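/- arXiv:math-ph/0101035 — 5 statements merged into one kernel-verified Lean document; each statement's English description precedes it below -/
import Mathlib

section
/- The BPS monopole solves the Bogomolny equations: let e¹,e²,e³ be a basis of su(2) with [e¹,e²] = e³, [e²,e³] = e¹, [e³,e¹] = e², set e(x) = Σᵢ xⁱeⁱ and r = |x|, and for x ≠ 0 define Φ(x) = (1/r − 1/tanh r)·e(x)/r and Aᵢ(x) = (1/sinh r − 1/r)·[e(x), eⁱ]/r. Then (A,Φ) satisfies the Bogomolny equations F₂₃ = ∇₁Φ, F₃₁ = ∇₂Φ, F₁₂ = ∇₃Φ on ℝ³ ∖ {0} (for the orientation of ℝ³ compatible with the chosen basis; with the opposite orientation convention it satisfies the anti-Bogomolny equations F = −*∇Φ). -/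
open Matrix

attribute [local instance] Matrix.normedAddCommGroup Matrix.normedSpace

abbrev M2 := Matrix (Fin 2) (Fin 2) ℂ

/-- Partial derivative in the `i`-th coordinate direction on `ℝ³`. -/
noncomputable def pd {E : Type*} [NormedAddCommGroup E] [NormedSpace ℝ E]
    (i : Fin 3) (f : (Fin 3 → ℝ) → E) (x : Fin 3 → ℝ) : E :=
  fderiv ℝ f x (Pi.single i 1)

/-- Membership in su(2): traceless and skew-Hermitian. -/
def isSu2 (X : M2) : Prop := X.trace = 0 ∧ Xᴴ = -X

/-- Membership in SU(2): unitary with determinant 1. -/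
def isSU2 (g : M2) : Prop := gᴴ * g = 1 ∧ g.det = 1

/-- Curvature components `F_{ij} = ∂ᵢAⱼ - ∂ⱼAᵢ + [Aᵢ, Aⱼ]`. -/
noncomputable def curv (A : Fin 3 → (Fin 3 → ℝ) → M2) (i j : Fin 3) (x : Fin 3 → ℝ) : M2 :=
  pd i (A j) x - pd j (A i) x + (A i x * A j x - A j x * A i x)

/-- Covariant derivative `∇ᵢX = ∂ᵢX + [Aᵢ, X]`. -/
noncomputable def covD (A : Fin 3 → (Fin 3 → ℝ) → M2) (i : Fin 3)
    (X : (Fin 3 → ℝ) → M2) (x : Fin 3 → ℝ) : M2 :=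
  pd i X x + (A i x * X x - X x * A i x)

/-- The gauge-transformed connection `A^g_i = g Aᵢ g⁻¹ + g ∂ᵢ(g⁻¹)`. -/
noncomputable def gaugeA (g : (Fin 3 → ℝ) → M2) (A : Fin 3 → (Fin 3 → ℝ) → M2)
    (i : Fin 3) (x : Fin 3 → ℝ) : M2 :=
  g x * A i x * (g x)⁻¹ + g x * pd i (fun y => (g y)⁻¹) x

/-- The partial derivatives of a radial function times a linear function. -/
theorem pd_radial_smul_linear {r : (Fin 3 → ℝ) → ℝ}
    (hr : ∀ x, r x = Real.sqrt ((x 0) ^ 2 + (x 1) ^ 2 + (x 2) ^ 2))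
    (v : Fin 3 → M2) {h : ℝ → ℝ} {h' : ℝ} {x : Fin 3 → ℝ} (hx : 0 < r x)
    (hh : HasDerivAt h h' (r x)) (i : Fin 3) :
    pd i (fun y => h (r y) • (y 0 • v 0 + y 1 • v 1 + y 2 • v 2)) x =
      (h' * (x i / r x)) • (x 0 • v 0 + x 1 • v 1 + x 2 • v 2) + h (r x) • v i := by
  have hp (k : Fin 3) : HasFDerivAt (fun y : Fin 3 → ℝ => y k)
      (ContinuousLinearMap.proj (R := ℝ) (φ := fun _ : Fin 3 => ℝ) k) x :=
    (ContinuousLinearMap.proj (R := ℝ) (φ := fun _ : Fin 3 => ℝ) k).hasFDerivAt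
  have hne : (x 0) ^ 2 + (x 1) ^ 2 + (x 2) ^ 2 ≠ 0 := by
    intro h0
    rw [hr, h0, Real.sqrt_zero] at hx
    exact lt_irrefl _ hx
  have hd := ((((hp 0).pow 2).add ((hp 1).pow 2)).add ((hp 2).pow 2)).sqrt hne
  have hd' : HasFDerivAt r _ x := hd.congr_of_eventuallyEq (.of_forall fun y => by simp [hr])
  have hL := (((hp 0).smul_const (v 0)).add ((hp 1).smul_const (v 1))).add
    ((hp 2).smul_const (v 2))
  have key := (hh.comp_hasFDerivAt x hd').smul hL
  have hrx := hr x
  unfold pd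
  erw [key.fderiv]
  rw [add_comm]
  have hx' := hx.ne'
  fin_cases i <;> simp [← hrx] <;> congr 1 <;> field_simp

/-- In a basis with the structure constants of `su(2)`, the bracket is the cross product. -/
theorem commutator_eq_cross {e : Fin 3 → M2}
    (h12 : e 0 * e 1 - e 1 * e 0 = e 2)
    (h23 : e 1 * e 2 - e 2 * e 1 = e 0)
    (h31 : e 2 * e 0 - e 0 * e 2 = e 1) (a b c a' b' c' : ℝ) :
    (a • e 0 + b • e 1 + c • e 2) * (a' • e 0 + b' • e 1 + c' • e 2) -
      (a' • e 0 + b' • e 1 + c' • e 2) * (a • e 0 + b • e 1 + c • e 2) =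
    (b * c' - c * b') • e 0 + (c * a' - a * c') • e 1 + (a * b' - b * a') • e 2 := by
  simp only [mul_add, add_mul, smul_mul_assoc, mul_smul_comm]
  linear_combination (norm := module) (a * b' - b * a') • h12 + (b * c' - c * b') • h23 +
    (c * a' - a * c') • h31

/-- The BPS monopole solves the Bogomolny equations away from the origin. -/
theorem bps_monopole_solves_bogomolny
    (e : Fin 3 → M2) (hesu : ∀ i, isSu2 (e i))
    (h12 : e 0 * e 1 - e 1 * e 0 = e 2)
    (h23 : e 1 * e 2 - e 2 * e 1 = e 0)
    (h31 : e 2 * e 0 - e 0 * e 2 = e 1)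
    (ev : (Fin 3 → ℝ) → M2) (hev : ∀ x, ev x = ∑ i : Fin 3, (x i : ℂ) • e i)
    (r : (Fin 3 → ℝ) → ℝ) (hr : ∀ x, r x = Real.sqrt ((x 0) ^ 2 + (x 1) ^ 2 + (x 2) ^ 2))
    (Φ : (Fin 3 → ℝ) → M2)
    (hΦ : ∀ x, Φ x = ((1 / r x - 1 / Real.tanh (r x)) / r x) • ev x)
    (A : Fin 3 → (Fin 3 → ℝ) → M2)
    (hA : ∀ i x, A i x = ((1 / Real.sinh (r x) - 1 / r x) / r x) •
      (ev x * e i - e i * ev x)) :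
    ∀ x : Fin 3 → ℝ, x ≠ 0 →
      curv A 1 2 x = covD A 0 Φ x ∧ curv A 2 0 x = covD A 1 Φ x ∧
        curv A 0 1 x = covD A 2 Φ x := by
  intro x hx
  have hr0 : 0 < r x := by
    rw [hr, Real.sqrt_pos]
    by_contra! hle
    apply hx
    ext k
    fin_cases k <;> simp <;> nlinarith [sq_nonneg (x 0), sq_nonneg (x 1), sq_nonneg (x 2)]
  have hsq : r x ^ 2 = x 0 ^ 2 + x 1 ^ 2 + x 2 ^ 2 := by
    rw [hr, Real.sq_sqrt (by positivity)]
  have hs : 0 < Real.sinh (r x) := Real.sinh_pos_iff.2 hr0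
  have hcs := Real.cosh_sq (r x)
  have hev' (y) : ev y = y 0 • e 0 + y 1 • e 1 + y 2 • e 2 := by
    simp only [hev, Fin.sum_univ_three, Complex.coe_smul]
  set g : ℝ → ℝ := fun t => (1 / Real.sinh t - 1 / t) / t with hg
  set f : ℝ → ℝ := fun t => (1 / t - Real.cosh t / Real.sinh t) / t with hf
  have hΦ' : Φ = fun y => f (r y) • (y 0 • e 0 + y 1 • e 1 + y 2 • e 2) := by
    funext y
    rw [hΦ, hev', hf, Real.tanh_eq_sinh_div_cosh, one_div_div]
  have hA0 : A 0 = fun y => g (r y) • (y 0 • (![0, -e 2, e 1] : Fin 3 → M2) 0 +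
      y 1 • (![0, -e 2, e 1] : Fin 3 → M2) 1 + y 2 • (![0, -e 2, e 1] : Fin 3 → M2) 2) := by
    funext y
    have := commutator_eq_cross h12 h23 h31 (y 0) (y 1) (y 2) 1 0 0
    simp only [one_smul, zero_smul, add_zero] at this
    rw [hA, hev', this]
    simp [hg]
    module
  have hA1 : A 1 = fun y => g (r y) • (y 0 • (![e 2, 0, -e 0] : Fin 3 → M2) 0 +
      y 1 • (![e 2, 0, -e 0] : Fin 3 → M2) 1 + y 2 • (![e 2, 0, -e 0] : Fin 3 → M2) 2) := by
    funext y
    have := commutator_eq_cross h12 h23 h31 (y 0) (y 1) (y 2) 0 1 0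
    simp only [one_smul, zero_smul, add_zero, zero_add] at this
    rw [hA, hev', this]
    simp [hg]
    module
  have hA2 : A 2 = fun y => g (r y) • (y 0 • (![-e 1, e 0, 0] : Fin 3 → M2) 0 +
      y 1 • (![-e 1, e 0, 0] : Fin 3 → M2) 1 + y 2 • (![-e 1, e 0, 0] : Fin 3 → M2) 2) := by
    funext y
    have := commutator_eq_cross h12 h23 h31 (y 0) (y 1) (y 2) 0 0 1
    simp only [one_smul, zero_smul, add_zero, zero_add] at this
    rw [hA, hev', this]
    simp [hg]
    module
  obtain ⟨g', hg', eg⟩ : ∃ g', HasDerivAt g g' (r x) ∧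
      g' = ((-Real.cosh (r x) / Real.sinh (r x) ^ 2 + 1 / r x ^ 2) * r x -
        (1 / Real.sinh (r x) - 1 / r x)) / r x ^ 2 := by
    refine ⟨_, ((((hasDerivAt_const (r x) (1 : ℝ)).div (Real.hasDerivAt_sinh (r x)) hs.ne').sub
      ((hasDerivAt_const (r x) (1 : ℝ)).div (hasDerivAt_id (r x)) hr0.ne')).div
      (hasDerivAt_id (r x)) hr0.ne'), ?_⟩
    simp
    ring
  obtain ⟨f', hf', ef⟩ : ∃ f', HasDerivAt f f' (r x) ∧
      f' = ((-1 / r x ^ 2 + 1 / Real.sinh (r x) ^ 2) * r x -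
        (1 / r x - Real.cosh (r x) / Real.sinh (r x))) / r x ^ 2 := by
    refine ⟨_, ((((hasDerivAt_const (r x) (1 : ℝ)).div (hasDerivAt_id (r x)) hr0.ne').sub
      ((Real.hasDerivAt_cosh (r x)).div (Real.hasDerivAt_sinh (r x)) hs.ne')).div
      (hasDerivAt_id (r x)) hr0.ne'), ?_⟩
    have : Real.sinh (r x) * Real.sinh (r x) - Real.cosh (r x) * Real.cosh (r x) = -1 := by
      linarith
    simp [this]
    ring
  have hfx : f (r x) = (1 / r x - Real.cosh (r x) / Real.sinh (r x)) / r x := rfl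
  have hgx : g (r x) = (1 / Real.sinh (r x) - 1 / r x) / r x := rfl
  have hpA (v : Fin 3 → M2) := pd_radial_smul_linear hr v hr0 hg'
  have hpΦ := pd_radial_smul_linear hr e hr0 hf'
  have ode₁ : g (r x) ^ 2 - g' / r x = f' / r x - g (r x) * f (r x) := by
    rw [hfx, hgx, eg, ef]
    field_simp
    ring
  have ode₂ : g' / r x * (x 0 ^ 2 + x 1 ^ 2 + x 2 ^ 2) + 2 * g (r x) =
      f (r x) + g (r x) * f (r x) * (x 0 ^ 2 + x 1 ^ 2 + x 2 ^ 2) := by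
    rw [← hsq, hfx, hgx, eg]
    field_simp
    ring
  clear_value f g
  have hc := commutator_eq_cross h12 h23 h31
  have hcA0 : A 0 x = (0 : ℝ) • e 0 + (g (r x) * x 2) • e 1 + (-(g (r x) * x 1)) • e 2 := by
    simp [hA0]
    module
  have hcA1 : A 1 x = (-(g (r x) * x 2)) • e 0 + (0 : ℝ) • e 1 + (g (r x) * x 0) • e 2 := by
    simp [hA1]
    module
  have hcA2 : A 2 x = (g (r x) * x 1) • e 0 + (-(g (r x) * x 0)) • e 1 + (0 : ℝ) • e 2 := by
    simp [hA2]
    module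
  have hcΦ : Φ x = (f (r x) * x 0) • e 0 + (f (r x) * x 1) • e 1 + (f (r x) * x 2) • e 2 := by
    simp only [hΦ']
    module
  unfold curv covD
  simp only [hcA0, hcA1, hcA2, hcΦ, hc]
  simp only [hA0, hA1, hA2, hΦ', hpA, hpΦ]
  simp only [cons_val]
  refine ⟨?_, ?_, ?_⟩
  · match_scalars
    · linear_combination x 0 * x 1 * ode₁
    · linear_combination x 0 ^ 2 * ode₁ + ode₂
    · linear_combination x 0 * x 2 * ode₁
  · match_scalars
    · linear_combination x 1 * x 2 * ode₁
    · linear_combination x 1 ^ 2 * ode₁ + ode₂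
    · linear_combination x 1 * x 0 * ode₁
  · match_scalars
    · linear_combination x 2 ^ 2 * ode₁ + ode₂
    · linear_combination x 2 * x 0 * ode₁
    · linear_combination x 2 * x 1 * ode₁
end

section
/- For a solution of the Bogomolny equations, the energy density equals half the ordinary Laplacian of the squared norm of the Higgs field: ½ Σ_{i<j} ⟨Fᵢⱼ,Fᵢⱼ⟩ + ½ Σᵢ ⟨∇ᵢΦ,∇ᵢΦ⟩ = ½ Σᵢ ∂ᵢ∂ᵢ ⟨Φ,Φ⟩ at every point of ℝ³. -/
open Matrix

attribute [local instance] Matrix.normedAddCommGroup Matrix.normedSpace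

/-- The Bogomolny equations `F₂₃ = ∇₁Φ, F₃₁ = ∇₂Φ, F₁₂ = ∇₃Φ`
(indices of `Fin 3` are shifted down by one). -/
def Bogomolny (A : Fin 3 → (Fin 3 → ℝ) → M2) (Φ : (Fin 3 → ℝ) → M2) : Prop :=
  ∀ x, curv A 1 2 x = covD A 0 Φ x ∧ curv A 2 0 x = covD A 1 Φ x ∧
    curv A 0 1 x = covD A 2 Φ x

/-- The invariant inner product `⟨X, Y⟩ = -tr(XY)` on su(2) (real-valued there). -/
noncomputable def ip (X Y : M2) : ℝ := (-(X * Y).trace).re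

/-- Leibniz rule for a real bilinear map on matrices. -/
theorem pd_bilin {E : Type*} [NormedAddCommGroup E] [NormedSpace ℝ E]
    (B : M2 →ₗ[ℝ] M2 →ₗ[ℝ] E) {f g : (Fin 3 → ℝ) → M2}
    (hf : Differentiable ℝ f) (hg : Differentiable ℝ g) (i : Fin 3) (x : Fin 3 → ℝ) :
    pd i (fun y => B (f y) (g y)) x = B (pd i f x) (g x) + B (f x) (pd i g x) := by
  have h := (B.toContinuousBilinearMap).hasFDerivAt_of_bilinear
    (hf x).hasFDerivAt (hg x).hasFDerivAt
  have h' : HasFDerivAt (fun y => B (f y) (g y)) _ x := h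
  rw [pd, h'.fderiv]
  exact add_comm _ _

theorem pd_mul {f g : (Fin 3 → ℝ) → M2}
    (hf : Differentiable ℝ f) (hg : Differentiable ℝ g) (i : Fin 3) (x : Fin 3 → ℝ) :
    pd i (fun y => f y * g y) x = pd i f x * g x + f x * pd i g x :=
  pd_bilin (LinearMap.mul ℝ M2) hf hg i x

theorem ContDiff.matrix_mul {n : WithTop ℕ∞} {f g : (Fin 3 → ℝ) → M2}
    (hf : ContDiff ℝ n f) (hg : ContDiff ℝ n g) : ContDiff ℝ n (fun y => f y * g y) :=
  (LinearMap.mul ℝ M2).toContinuousBilinearMap.isBoundedBilinearMap.contDiff.comp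
    (hf.prodMk hg)

/-- The form `ip` as a real bilinear map. -/
noncomputable def ipBilin : M2 →ₗ[ℝ] M2 →ₗ[ℝ] ℝ :=
  LinearMap.mk₂ ℝ ip
    (by intros; simp [ip, add_mul]; ring) (by intros; simp [ip])
    (by intros; simp [ip, mul_add]; ring) (by intros; simp [ip])

theorem pd_ip {f g : (Fin 3 → ℝ) → M2}
    (hf : Differentiable ℝ f) (hg : Differentiable ℝ g) (i : Fin 3) (x : Fin 3 → ℝ) :
    pd i (fun y => ip (f y) (g y)) x = ip (pd i f x) (g x) + ip (f x) (pd i g x) :=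
  pd_bilin ipBilin hf hg i x

theorem ip_comm (X Y : M2) : ip X Y = ip Y X := by
  rw [ip, ip, Matrix.trace_mul_comm]

theorem ip_add_left (X Y Z : M2) : ip (X + Y) Z = ip X Z + ip Y Z :=
  ipBilin.map_add₂ X Y Z

theorem ip_zero_left (X : M2) : ip 0 X = 0 := by simp [ip]

theorem ip_neg_neg (X : M2) : ip (-X) (-X) = ip X X := by simp [ip]

/-- Invariance of `ip` under the adjoint action. -/
theorem ip_commutator (T X Y : M2) :
    ip (T * X - X * T) Y + ip X (T * Y - Y * T) = 0 := by
  have h : (T * X * Y).trace = (X * Y * T).trace := by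
    rw [mul_assoc, Matrix.trace_mul_comm]
  simp [ip, sub_mul, mul_sub, ← mul_assoc, h]

/-- Metric compatibility of the covariant derivative. -/
theorem pd_ip_covD (A : Fin 3 → (Fin 3 → ℝ) → M2) {f g : (Fin 3 → ℝ) → M2}
    (hf : Differentiable ℝ f) (hg : Differentiable ℝ g) (i : Fin 3) (x : Fin 3 → ℝ) :
    pd i (fun y => ip (f y) (g y)) x = ip (covD A i f x) (g x) + ip (f x) (covD A i g x) := by
  have h := ip_commutator (A i x) (f x) (g x)
  rw [pd_ip hf hg, covD, covD, ip_add_left, ip_comm (f x) (_ + _), ip_add_left,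
    ip_comm _ (f x), ip_comm _ (f x)]
  linarith

theorem ContDiff.pd {E : Type*} [NormedAddCommGroup E] [NormedSpace ℝ E]
    {f : (Fin 3 → ℝ) → E} (hf : ContDiff ℝ (⊤ : ℕ∞) f) (i : Fin 3) :
    ContDiff ℝ (⊤ : ℕ∞) (pd i f) :=
  (hf.fderiv_right (m := (⊤ : ℕ∞)) (by simp)).clm_apply contDiff_const

theorem ContDiff.covD {A : Fin 3 → (Fin 3 → ℝ) → M2} {f : (Fin 3 → ℝ) → M2}
    (hA : ∀ i, ContDiff ℝ (⊤ : ℕ∞) (A i)) (hf : ContDiff ℝ (⊤ : ℕ∞) f) (i : Fin 3) :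
    ContDiff ℝ (⊤ : ℕ∞) (covD A i f) :=
  (hf.pd i).add (((hA i).matrix_mul hf).sub (hf.matrix_mul (hA i)))

theorem pd_pd_comm {E : Type*} [NormedAddCommGroup E] [NormedSpace ℝ E]
    {f : (Fin 3 → ℝ) → E} (hf : ContDiff ℝ (⊤ : ℕ∞) f) (i j : Fin 3) (x : Fin 3 → ℝ) :
    pd i (pd j f) x = pd j (pd i f) x := by
  have hd : DifferentiableAt ℝ (fderiv ℝ f) x :=
    (hf.fderiv_right (m := (⊤ : ℕ∞)) (by simp)).differentiable (by simp) x
  have key (k l : Fin 3) :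
      pd k (pd l f) x = fderiv ℝ (fderiv ℝ f) x (Pi.single k 1) (Pi.single l 1) := by
    have h := hd.hasFDerivAt.clm_apply
      (hasFDerivAt_const (Pi.single l (1 : ℝ) : Fin 3 → ℝ) x)
    have h' : HasFDerivAt (pd l f) _ x := h
    rw [pd, h'.fderiv]
    simp
  rw [key, key]
  exact hf.contDiffAt.isSymmSndFDerivAt (by simpa using WithTop.coe_le_coe.2 (le_top : (2 : ℕ∞) ≤ ⊤)) _ _

theorem pd_curv {A : Fin 3 → (Fin 3 → ℝ) → M2} (hA : ∀ i, ContDiff ℝ (⊤ : ℕ∞) (A i))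
    (k i j : Fin 3) (x : Fin 3 → ℝ) :
    pd k (curv A i j) x = pd k (pd i (A j)) x - pd k (pd j (A i)) x
      + ((pd k (A i) x * A j x + A i x * pd k (A j) x)
        - (pd k (A j) x * A i x + A j x * pd k (A i) x)) := by
  have hd (l : Fin 3) : Differentiable ℝ (A l) := (hA l).differentiable (by simp)
  have h1 (l m : Fin 3) : DifferentiableAt ℝ (pd l (A m)) x :=
    ((hA m).pd l).differentiable (by simp) x
  have h2 (l m : Fin 3) : DifferentiableAt ℝ (fun y => A l y * A m y) x :=
    ((hA l).matrix_mul (hA m)).differentiable (by simp) x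
  have h := ((h1 i j).hasFDerivAt.sub (h1 j i).hasFDerivAt).add
    ((h2 i j).hasFDerivAt.sub (h2 j i).hasFDerivAt)
  have h' : HasFDerivAt (curv A i j) _ x := h
  rw [← pd_mul (hd i) (hd j), ← pd_mul (hd j) (hd i)]
  exact DFunLike.congr_fun h'.fderiv (Pi.single k 1)

/-- The Bianchi identity. -/
theorem bianchi {A : Fin 3 → (Fin 3 → ℝ) → M2} (hA : ∀ i, ContDiff ℝ (⊤ : ℕ∞) (A i))
    (i j k : Fin 3) (x : Fin 3 → ℝ) :
    covD A i (curv A j k) x + covD A j (curv A k i) x + covD A k (curv A i j) x = 0 := by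
  simp only [covD, pd_curv hA]
  rw [pd_pd_comm (hA k) i j, pd_pd_comm (hA j) i k, pd_pd_comm (hA i) j k]
  simp only [curv]
  noncomm_ring

theorem curv_swap (A : Fin 3 → (Fin 3 → ℝ) → M2) (i j : Fin 3) (x : Fin 3 → ℝ) :
    curv A i j x = -curv A j i x := by
  simp only [curv]
  abel

/-- For any connection, the Laplacian of `⟨Φ, Φ⟩` in terms of covariant derivatives. -/
theorem pd_pd_ip_self {A : Fin 3 → (Fin 3 → ℝ) → M2} {Φ : (Fin 3 → ℝ) → M2}
    (hA : ∀ i, ContDiff ℝ (⊤ : ℕ∞) (A i)) (hΦ : ContDiff ℝ (⊤ : ℕ∞) Φ)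
    (i : Fin 3) (x : Fin 3 → ℝ) :
    pd i (fun y => pd i (fun w => ip (Φ w) (Φ w)) y) x
      = 2 * (ip (covD A i (covD A i Φ) x) (Φ x) + ip (covD A i Φ x) (covD A i Φ x)) := by
  have hd : Differentiable ℝ Φ := hΦ.differentiable (by simp)
  have hD : Differentiable ℝ (covD A i Φ) := (hΦ.covD hA i).differentiable (by simp)
  have h : (fun y => pd i (fun w => ip (Φ w) (Φ w)) y)
      = fun y => ip (((2 : ℝ) • covD A i Φ) y) (Φ y) := by
    funext y
    rw [pd_ip_covD A hd hd, ip_comm (Φ y)]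
    simp only [Pi.smul_apply, two_smul, ip_add_left]
  have h2 : pd i ((2 : ℝ) • covD A i Φ) x = (2 : ℝ) • pd i (covD A i Φ) x := by
    simp only [pd]
    rw [fderiv_const_smul (hD x)]
    rfl
  rw [h, pd_ip_covD A (hD.const_smul (2 : ℝ)) hd]
  have h3 : covD A i ((2 : ℝ) • covD A i Φ) x = (2 : ℝ) • covD A i (covD A i Φ) x := by
    rw [covD, h2, covD]
    simp only [Pi.smul_apply, mul_smul_comm, smul_mul_assoc, smul_add, smul_sub]
  rw [h3, Pi.smul_apply, two_smul, two_smul, ip_add_left, ip_add_left]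
  ring

/-- For a monopole, the energy density equals half the ordinary Laplacian of
`⟨Φ, Φ⟩`. -/
theorem energy_density_eq_laplacian (A : Fin 3 → (Fin 3 → ℝ) → M2)
    (hA : ∀ i, ContDiff ℝ (⊤ : ℕ∞) (A i)) (hAsu : ∀ i x, isSu2 (A i x))
    (Φ : (Fin 3 → ℝ) → M2) (hΦ : ContDiff ℝ (⊤ : ℕ∞) Φ) (hΦsu : ∀ x, isSu2 (Φ x))
    (hBog : Bogomolny A Φ) (x : Fin 3 → ℝ) :
    (1 / 2) * (ip (curv A 0 1 x) (curv A 0 1 x) + ip (curv A 0 2 x) (curv A 0 2 x)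
        + ip (curv A 1 2 x) (curv A 1 2 x))
      + (1 / 2) * ∑ i : Fin 3, ip (covD A i Φ x) (covD A i Φ x)
      = (1 / 2) * ∑ i : Fin 3, pd i (fun y => pd i (fun w => ip (Φ w) (Φ w)) y) x := by
  have h0 : curv A 1 2 = covD A 0 Φ := funext fun y => (hBog y).1
  have h1 : curv A 2 0 = covD A 1 Φ := funext fun y => (hBog y).2.1
  have h2 : curv A 0 1 = covD A 2 Φ := funext fun y => (hBog y).2.2
  have hB := congrArg (fun X => ip X (Φ x)) (bianchi hA 0 1 2 x)
  simp only [h0, h1, h2, ip_add_left, ip_zero_left] at hB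
  rw [curv_swap A 0 2, ip_neg_neg, h0, h1, h2]
  simp only [pd_pd_ip_self hA hΦ, Fin.sum_univ_three]
  linarith
end

section
/- Nahm's equations are equivalent to a Lax equation: let T₁, T₂, T₃ : I → M_k(ℂ) be differentiable matrix-valued functions on an interval I, and for ζ ∈ ℂ set A(ζ,z) = (T₁(z) + iT₂(z)) + 2T₃(z)ζ + (−T₁(z) + iT₂(z))ζ² and A₊(ζ,z) = iT₃(z) − (iT₁(z) + T₂(z))ζ. Then the Nahm equations dT₁/dz = [T₂,T₃], dT₂/dz = [T₃,T₁], dT₃/dz = [T₁,T₂] hold at z if and only if ∂A/∂z(ζ,z) = [A₊(ζ,z), A(ζ,z)] for all ζ ∈ ℂ. -/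
open Matrix

attribute [local instance] Matrix.normedAddCommGroup Matrix.normedSpace

/-- The Lax commutator `[A₊(ζ), A(ζ)]` is the quadratic polynomial in `ζ` built from the commutators
`[b, c]`, `[c, a]`, `[a, b]` in the way `A(ζ)` is built from `a`, `b`, `c`. -/
theorem lax_commutator_eq {R : Type*} [Ring R] [Algebra ℂ R] (a b c : R) (ζ : ℂ) :
    (Complex.I • c - ζ • (Complex.I • a + b)) *
          ((a + Complex.I • b) + (2 * ζ) • c + ζ ^ 2 • (-a + Complex.I • b))
        - ((a + Complex.I • b) + (2 * ζ) • c + ζ ^ 2 • (-a + Complex.I • b)) *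
          (Complex.I • c - ζ • (Complex.I • a + b))
      = ((b * c - c * b) + Complex.I • (c * a - a * c)) + (2 * ζ) • (a * b - b * a)
        + ζ ^ 2 • (-(b * c - c * b) + Complex.I • (c * a - a * c)) := by
  simp only [mul_add, add_mul, sub_mul, mul_sub, smul_mul_assoc, mul_smul_comm, neg_mul, mul_neg]
  match_scalars <;> ring_nf <;> simp only [Complex.I_sq] <;> ring

/-- A quadratic polynomial `(x + i y) + 2 ζ w + ζ² (-x + i y)` with vector coefficients vanishes
for all `ζ` only if `x`, `y` and `w` vanish. -/
theorem eq_zero_of_forall_lax_quadratic_eq_zero {V : Type*} [AddCommGroup V] [Module ℂ V]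
    {x y w : V}
    (h : ∀ ζ : ℂ, (x + Complex.I • y) + (2 * ζ) • w + ζ ^ 2 • (-x + Complex.I • y) = 0) :
    x = 0 ∧ y = 0 ∧ w = 0 := by
  have h₀ : x + Complex.I • y = 0 := by simpa using h 0
  have h₁ := h 1
  have h₂ := h (-1)
  have hw : w = (4⁻¹ : ℂ) • (((x + Complex.I • y) + (2 * (1 : ℂ)) • w
      + (1 : ℂ) ^ 2 • (-x + Complex.I • y)) - ((x + Complex.I • y) + (2 * (-1 : ℂ)) • w
      + (-1 : ℂ) ^ 2 • (-x + Complex.I • y))) := by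
    module
  rw [h₁, h₂, sub_zero, smul_zero] at hw
  have hy : Complex.I • y = 0 := by
    have h₃ : (2 : ℂ) • (Complex.I • y) = 0 := by
      rw [← h₁, hw]
      module
    exact (smul_eq_zero_iff_right two_ne_zero).mp h₃
  refine ⟨by simpa [hy] using h₀, (smul_eq_zero_iff_right Complex.I_ne_zero).mp hy, hw⟩

/-- Nahm's equations are equivalent to the Lax form: with
`A(ζ,z) = (T₁ + iT₂) + 2T₃ ζ + (-T₁ + iT₂) ζ²` and
`A₊(ζ,z) = iT₃ - (iT₁ + T₂) ζ`, the Nahm equations hold at `z` if and only if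
`∂A/∂z (ζ,z) = [A₊(ζ,z), A(ζ,z)]` for all `ζ ∈ ℂ`. -/
theorem nahm_equations_iff_lax_form {k : ℕ}
    (T : Fin 3 → ℝ → Matrix (Fin k) (Fin k) ℂ)
    (T' : Fin 3 → Matrix (Fin k) (Fin k) ℂ) (z : ℝ)
    (hT : ∀ i, HasDerivAt (T i) (T' i) z) :
    (T' 0 = T 1 z * T 2 z - T 2 z * T 1 z ∧
     T' 1 = T 2 z * T 0 z - T 0 z * T 2 z ∧
     T' 2 = T 0 z * T 1 z - T 1 z * T 0 z)
    ↔ ∀ ζ : ℂ,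
        HasDerivAt
          (fun w => (T 0 w + Complex.I • T 1 w) + (2 * ζ) • T 2 w
            + ζ ^ 2 • (-T 0 w + Complex.I • T 1 w))
          ((Complex.I • T 2 z - ζ • (Complex.I • T 0 z + T 1 z)) *
              ((T 0 z + Complex.I • T 1 z) + (2 * ζ) • T 2 z
                + ζ ^ 2 • (-T 0 z + Complex.I • T 1 z))
            - ((T 0 z + Complex.I • T 1 z) + (2 * ζ) • T 2 z
                + ζ ^ 2 • (-T 0 z + Complex.I • T 1 z)) *
              (Complex.I • T 2 z - ζ • (Complex.I • T 0 z + T 1 z))) z := by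
  have hA (ζ : ℂ) := (((hT 0).add ((hT 1).const_smul Complex.I)).add
    ((hT 2).const_smul (2 * ζ))).add
      (((hT 0).neg.add ((hT 1).const_smul Complex.I)).const_smul (ζ ^ 2))
  simp only [lax_commutator_eq]
  constructor
  · rintro ⟨h₀, h₁, h₂⟩ ζ
    rw [← h₀, ← h₁, ← h₂]
    exact hA ζ
  · intro h
    have key := eq_zero_of_forall_lax_quadratic_eq_zero
      (x := T' 0 - (T 1 z * T 2 z - T 2 z * T 1 z))
      (y := T' 1 - (T 2 z * T 0 z - T 0 z * T 2 z))
      (w := T' 2 - (T 0 z * T 1 z - T 1 z * T 0 z)) fun ζ => by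
        rw [← sub_eq_zero.mpr ((hA ζ).unique (h ζ))]
        module
    simpa only [sub_eq_zero] using key
end

section
/- Incidence of points and lines in mini-twistor coordinates: let u ∈ ℝ³ with |u| = 1 and u ≠ (0,0,1), and v ∈ ℝ³ with ⟨u,v⟩ = 0, and set ζ = (u¹ + iu²)/(1 − u³) and η = (v¹ + iv²) + 2v³ζ + (−v¹ + iv²)ζ². Then a point x = (x¹,x²,x³) ∈ ℝ³ lies on the line {v + tu : t ∈ ℝ} if and only if η = (x¹ + ix²) + 2x³ζ + (−x¹ + ix²)ζ². -/
open Complex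

/-- For a unit vector `(a, b, c)` with `c ≠ 1`, the incidence form at `ζ = (a + ib) / (1 - c)`
vanishes on `(p, q, r)` exactly when two real linear equations hold. -/
theorem incidenceForm_eq_zero_iff {a b c p q r : ℝ} (h : a ^ 2 + b ^ 2 + c ^ 2 = 1)
    (hc : 1 - c ≠ 0) :
    ((p : ℂ) + q * I) + 2 * r * ((a + b * I) / (1 - c))
        + (-(p : ℂ) + q * I) * ((a + b * I) / (1 - c)) ^ 2 = 0
      ↔ (1 - c) * p = a * (a * p + b * q - (1 - c) * r) ∧
        (1 - c) * q = b * (a * p + b * q - (1 - c) * r) := by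
  have hc' : (1 - c : ℂ) ≠ 0 := mod_cast hc
  have hI := I_sq
  have hC : (a ^ 2 + b ^ 2 + c ^ 2 : ℂ) = 1 := mod_cast h
  have key : (((p : ℂ) + q * I) + 2 * r * ((a + b * I) / (1 - c))
      + (-(p : ℂ) + q * I) * ((a + b * I) / (1 - c)) ^ 2) * (1 - c) ^ 2
      = 2 * (((1 - c) * p - a * (a * p + b * q - (1 - c) * r) : ℝ)
        + ((1 - c) * q - b * (a * p + b * q - (1 - c) * r) : ℝ) * I) := by
    field_simp
    push_cast
    linear_combination (-(p : ℂ) * b ^ 2 + 2 * a * b * q + q * b ^ 2 * I) * hI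
      + ((p : ℂ) + q * I) * hC
  rw [← mul_left_inj' (pow_ne_zero 2 hc'), key, zero_mul, mul_eq_zero_iff_left two_ne_zero,
    Complex.ext_iff]
  simp [-ofReal_sub, -ofReal_mul, -ofReal_add, sub_eq_zero]

/-- The two real equations above cut out the line spanned by the unit vector `(a, b, c)`. -/
theorem incidence_equations_iff {a b c p q r : ℝ} (h : a ^ 2 + b ^ 2 + c ^ 2 = 1)
    (hc : 1 - c ≠ 0) :
    ((1 - c) * p = a * (a * p + b * q - (1 - c) * r) ∧
        (1 - c) * q = b * (a * p + b * q - (1 - c) * r))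
      ↔ ∃ t : ℝ, p = t * a ∧ q = t * b ∧ r = t * c := by
  constructor
  · rintro ⟨h₀, h₁⟩
    have h₂ : r = (a * p + b * q + c * r) * c := by
      apply mul_left_cancel₀ hc
      linear_combination a * h₀ + b * h₁ + (a * p + b * q - (1 - c) * r) * h
    refine ⟨a * p + b * q + c * r, ?_, ?_, h₂⟩
    · apply mul_left_cancel₀ hc
      linear_combination h₀ - a * h₂
    · apply mul_left_cancel₀ hc
      linear_combination h₁ - b * h₂
  · rintro ⟨t, rfl, rfl, rfl⟩
    constructor
    · linear_combination -a * t * h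
    · linear_combination -b * t * h

/-- Incidence of points and lines in mini-twistor coordinates: a point `x ∈ ℝ³`
lies on the oriented line `{v + t u}` (with `|u| = 1`, `⟨u,v⟩ = 0`,
`u ≠ (0,0,1)`) if and only if its mini-twistor coordinates satisfy
`η = (x¹ + ix²) + 2x³ ζ + (-x¹ + ix²) ζ²`. -/
theorem minitwistor_incidence (u v x : Fin 3 → ℝ)
    (hu : u 0 ^ 2 + u 1 ^ 2 + u 2 ^ 2 = 1)
    (huv : u 0 * v 0 + u 1 * v 1 + u 2 * v 2 = 0)
    (hu3 : u ≠ ![0, 0, 1])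
    (ζ η : ℂ)
    (hζ : ζ = ((u 0 : ℂ) + (u 1 : ℂ) * I) / (1 - (u 2 : ℂ)))
    (hη : η = ((v 0 : ℂ) + (v 1 : ℂ) * I) + 2 * (v 2 : ℂ) * ζ
        + (-(v 0 : ℂ) + (v 1 : ℂ) * I) * ζ ^ 2) :
    (∃ t : ℝ, ∀ i, x i = v i + t * u i)
      ↔ η = ((x 0 : ℂ) + (x 1 : ℂ) * I) + 2 * (x 2 : ℂ) * ζ
          + (-(x 0 : ℂ) + (x 1 : ℂ) * I) * ζ ^ 2 := by
  have hc : 1 - u 2 ≠ 0 := by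
    intro h
    have h₂ : u 2 = 1 := by linarith
    have h₀ : u 0 = 0 := by nlinarith [sq_nonneg (u 0), sq_nonneg (u 1)]
    have h₁ : u 1 = 0 := by nlinarith [sq_nonneg (u 0), sq_nonneg (u 1)]
    apply hu3
    ext i
    fin_cases i <;> simp [h₀, h₁, h₂]
  have hform := (incidenceForm_eq_zero_iff (p := x 0 - v 0) (q := x 1 - v 1) (r := x 2 - v 2)
    hu hc).trans (incidence_equations_iff hu hc)
  rw [← hζ] at hform
  rw [hη, eq_comm, ← sub_eq_zero]
  push_cast at hform
  convert hform.symm using 1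
  · simp [Fin.forall_fin_succ, sub_eq_iff_eq_add']
  · congr! 1
    ring
end

section
/- The Weitzenböck-type identity for the coupled Dirac operator: let σ¹ = [[0,i],[i,0]], σ² = [[0,1],[−1,0]], σ³ = [[i,0],[0,−i]] (these are i times the Pauli matrices). For smooth ψ : ℝ³ → ℂ²⊗ℂ² define ∇ᵢψ = ∂ᵢψ + (I⊗Aᵢ)ψ, and for z ∈ ℝ define D_zψ = Σᵢ (σⁱ⊗I)∇ᵢψ − (I⊗Φ + iz·I⊗I)ψ and D*_zψ = Σᵢ (σⁱ⊗I)∇ᵢψ + (I⊗Φ + iz·I⊗I)ψ. If (A,Φ) satisfies the Bogomolny equations, then for all smooth ψ: D_z(D*_zψ) = −Σᵢ ∇ᵢ(∇ᵢψ) − (I⊗Φ + iz·I⊗I)²ψ. -/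
open Matrix

attribute [local instance] Matrix.normedAddCommGroup Matrix.normedSpace

open Kronecker

/-- `σⁱ`, i.e. `i` times the Pauli matrices. -/
noncomputable def sigma : Fin 3 → M2 :=
  ![!![0, Complex.I; Complex.I, 0], !![0, 1; -1, 0], !![Complex.I, 0; 0, -Complex.I]]

/-- Covariant derivative `∇ᵢψ = ∂ᵢψ + (I ⊗ Aᵢ)ψ` of a spinor field
`ψ : ℝ³ → ℂ² ⊗ ℂ²`. -/
noncomputable def covDSpinor (A : Fin 3 → (Fin 3 → ℝ) → M2) (i : Fin 3)
    (ψ : (Fin 3 → ℝ) → (Fin 2 × Fin 2 → ℂ)) (x : Fin 3 → ℝ) : Fin 2 × Fin 2 → ℂ :=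
  pd i ψ x + ((1 : M2) ⊗ₖ A i x).mulVec (ψ x)

/-- The coupled Dirac operator `D_z ψ = Σᵢ (σⁱ⊗I) ∇ᵢψ - (I⊗Φ + iz·I⊗I) ψ`. -/
noncomputable def dirac (A : Fin 3 → (Fin 3 → ℝ) → M2) (Φ : (Fin 3 → ℝ) → M2)
    (z : ℝ) (ψ : (Fin 3 → ℝ) → (Fin 2 × Fin 2 → ℂ)) (x : Fin 3 → ℝ) :
    Fin 2 × Fin 2 → ℂ :=
  ∑ i : Fin 3, (sigma i ⊗ₖ (1 : M2)).mulVec (covDSpinor A i ψ x)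
    - (((1 : M2) ⊗ₖ Φ x) + (Complex.I * (z : ℂ)) • ((1 : M2) ⊗ₖ (1 : M2))).mulVec (ψ x)

/-- The adjoint Dirac operator `D*_z ψ = Σᵢ (σⁱ⊗I) ∇ᵢψ + (I⊗Φ + iz·I⊗I) ψ`. -/
noncomputable def diracStar (A : Fin 3 → (Fin 3 → ℝ) → M2) (Φ : (Fin 3 → ℝ) → M2)
    (z : ℝ) (ψ : (Fin 3 → ℝ) → (Fin 2 × Fin 2 → ℂ)) (x : Fin 3 → ℝ) :
    Fin 2 × Fin 2 → ℂ :=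
  ∑ i : Fin 3, (sigma i ⊗ₖ (1 : M2)).mulVec (covDSpinor A i ψ x)
    + (((1 : M2) ⊗ₖ Φ x) + (Complex.I * (z : ℂ)) • ((1 : M2) ⊗ₖ (1 : M2))).mulVec (ψ x)

section SpinorCalculus

variable {ψ : (Fin 3 → ℝ) → (Fin 2 × Fin 2 → ℂ)} {A : Fin 3 → (Fin 3 → ℝ) → M2}

section PartialDerivative

variable {E : Type*} [NormedAddCommGroup E] [NormedSpace ℝ E] {x : Fin 3 → ℝ}

theorem pd_add (i : Fin 3) {f g : (Fin 3 → ℝ) → E}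
    (hf : DifferentiableAt ℝ f x) (hg : DifferentiableAt ℝ g x) :
    pd i (fun y => f y + g y) x = pd i f x + pd i g x := by
  simp only [pd]
  rw [fderiv_fun_add hf hg]
  rfl

theorem contDiff_pd (i : Fin 3) {f : (Fin 3 → ℝ) → E} (hf : ContDiff ℝ (⊤ : ℕ∞) f) :
    ContDiff ℝ (⊤ : ℕ∞) (fun y => pd i f y) :=
  (hf.fderiv_right (m := (⊤ : ℕ∞)) (by simp)).clm_apply contDiff_const

theorem pd_comm (i j : Fin 3) {f : (Fin 3 → ℝ) → E} (hf : ContDiff ℝ (⊤ : ℕ∞) f)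
    (x : Fin 3 → ℝ) :
    pd i (fun y => pd j f y) x = pd j (fun y => pd i f y) x := by
  have hd : DifferentiableAt ℝ (fderiv ℝ f) x :=
    ((hf.fderiv_right (m := (⊤ : ℕ∞)) (by simp)).differentiable (by simp)) x
  have hpd (k l : Fin 3) : pd k (fun y => pd l f y) x
      = fderiv ℝ (fderiv ℝ f) x (Pi.single k 1) (Pi.single l 1) := by
    simp only [pd]
    rw [fderiv_clm_apply hd (differentiableAt_const _)]
    simp
  have hsymm : IsSymmSndFDerivAt ℝ f x :=
    hf.contDiffAt.isSymmSndFDerivAt (by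
      rw [minSmoothness_of_isRCLikeNormedField]
      exact WithTop.coe_le_coe.2 (le_top : (2 : ℕ∞) ≤ ⊤))
  rw [hpd, hpd]
  exact hsymm _ _

/-- The action of the second tensor factor, as a real bilinear map. -/
noncomputable def oneKronMulVec : M2 →ₗ[ℝ] (Fin 2 × Fin 2 → ℂ) →ₗ[ℝ] (Fin 2 × Fin 2 → ℂ) :=
  LinearMap.mk₂ ℝ (fun B v => ((1 : M2) ⊗ₖ B) *ᵥ v)
    (fun B C v => by rw [kronecker_add, add_mulVec])
    (fun c B v => by rw [kronecker_smul, smul_mulVec])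
    (fun B v w => mulVec_add _ _ _)
    (fun c B v => mulVec_smul _ _ _)

theorem oneKron_sub_mulVec (B C : M2) (v : Fin 2 × Fin 2 → ℂ) :
    ((1 : M2) ⊗ₖ (B - C)) *ᵥ v = ((1 : M2) ⊗ₖ B) *ᵥ v - ((1 : M2) ⊗ₖ C) *ᵥ v :=
  congrArg (fun L => L v) (map_sub oneKronMulVec B C)

theorem hasFDerivAt_oneKron_mulVec {B : (Fin 3 → ℝ) → M2}
    (hB : DifferentiableAt ℝ B x) (hψ : DifferentiableAt ℝ ψ x) :
    ∃ L : (Fin 3 → ℝ) →L[ℝ] (Fin 2 × Fin 2 → ℂ),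
      HasFDerivAt (fun y => ((1 : M2) ⊗ₖ B y) *ᵥ ψ y) L x ∧
      ∀ v, L v = ((1 : M2) ⊗ₖ B x) *ᵥ fderiv ℝ ψ x v
        + ((1 : M2) ⊗ₖ fderiv ℝ B x v) *ᵥ ψ x :=
  ⟨_, (oneKronMulVec.toContinuousBilinearMap).hasFDerivAt_of_bilinear
    hB.hasFDerivAt hψ.hasFDerivAt, fun _ => rfl⟩

theorem pd_oneKron_mulVec (i : Fin 3) {B : (Fin 3 → ℝ) → M2}
    (hB : DifferentiableAt ℝ B x) (hψ : DifferentiableAt ℝ ψ x) :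
    pd i (fun y => ((1 : M2) ⊗ₖ B y) *ᵥ ψ y) x
      = ((1 : M2) ⊗ₖ B x) *ᵥ pd i ψ x + ((1 : M2) ⊗ₖ pd i B x) *ᵥ ψ x := by
  obtain ⟨L, hL, hLv⟩ := hasFDerivAt_oneKron_mulVec hB hψ
  simp only [pd]
  rw [hL.fderiv, hLv]
  rfl

theorem contDiff_oneKron_mulVec {B : (Fin 3 → ℝ) → M2}
    (hB : ContDiff ℝ (⊤ : ℕ∞) B) (hψ : ContDiff ℝ (⊤ : ℕ∞) ψ) :
    ContDiff ℝ (⊤ : ℕ∞) (fun y => ((1 : M2) ⊗ₖ B y) *ᵥ ψ y) :=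
  (oneKronMulVec.toContinuousBilinearMap).isBoundedBilinearMap.contDiff.comp (hB.prodMk hψ)

theorem contDiff_const_mulVec (M : Matrix (Fin 2 × Fin 2) (Fin 2 × Fin 2) ℂ)
    (hψ : ContDiff ℝ (⊤ : ℕ∞) ψ) : ContDiff ℝ (⊤ : ℕ∞) (fun y => M *ᵥ ψ y) :=
  ((M.mulVecLin.restrictScalars ℝ).toContinuousLinearMap).contDiff.comp hψ

theorem pd_const_mulVec (i : Fin 3) (M : Matrix (Fin 2 × Fin 2) (Fin 2 × Fin 2) ℂ)
    (hψ : DifferentiableAt ℝ ψ x) :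
    pd i (fun y => M *ᵥ ψ y) x = M *ᵥ pd i ψ x := by
  have h : HasFDerivAt (fun y => M *ᵥ ψ y) _ x :=
    ((M.mulVecLin.restrictScalars ℝ).toContinuousLinearMap).hasFDerivAt.comp x hψ.hasFDerivAt
  simp only [pd]
  rw [h.fderiv]
  rfl

end PartialDerivative

section CovariantDerivative

theorem contDiff_covDSpinor (hA : ∀ i, ContDiff ℝ (⊤ : ℕ∞) (A i))
    (hψ : ContDiff ℝ (⊤ : ℕ∞) ψ) (i : Fin 3) :
    ContDiff ℝ (⊤ : ℕ∞) (fun y => covDSpinor A i ψ y) :=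
  (contDiff_pd i hψ).add (contDiff_oneKron_mulVec (hA i) hψ)

theorem covDSpinor_add (i : Fin 3) {φ : (Fin 3 → ℝ) → (Fin 2 × Fin 2 → ℂ)}
    (hψ : ContDiff ℝ (⊤ : ℕ∞) ψ) (hφ : ContDiff ℝ (⊤ : ℕ∞) φ) (x : Fin 3 → ℝ) :
    covDSpinor A i (fun y => ψ y + φ y) x = covDSpinor A i ψ x + covDSpinor A i φ x := by
  simp only [covDSpinor]
  rw [pd_add i (hψ.differentiable (by simp) x) (hφ.differentiable (by simp) x), mulVec_add]
  abel

/-- Constant endomorphisms of the spin space are covariantly constant. -/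
theorem covDSpinor_kron_one (i : Fin 3) (S : M2) (hψ : ContDiff ℝ (⊤ : ℕ∞) ψ)
    (x : Fin 3 → ℝ) :
    covDSpinor A i (fun y => (S ⊗ₖ (1 : M2)) *ᵥ ψ y) x
      = (S ⊗ₖ (1 : M2)) *ᵥ covDSpinor A i ψ x := by
  simp only [covDSpinor]
  rw [pd_const_mulVec i _ (hψ.differentiable (by simp) x), mulVec_add, mulVec_mulVec,
    mulVec_mulVec, ← mul_kronecker_mul, ← mul_kronecker_mul]
  simp only [one_mul, mul_one]

theorem covDSpinor_oneKron (i : Fin 3) {B : (Fin 3 → ℝ) → M2}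
    (hB : ContDiff ℝ (⊤ : ℕ∞) B) (hψ : ContDiff ℝ (⊤ : ℕ∞) ψ) (x : Fin 3 → ℝ) :
    covDSpinor A i (fun y => ((1 : M2) ⊗ₖ B y) *ᵥ ψ y) x
      = ((1 : M2) ⊗ₖ covD A i B x) *ᵥ ψ x + ((1 : M2) ⊗ₖ B x) *ᵥ covDSpinor A i ψ x := by
  simp only [covDSpinor, covD]
  rw [pd_oneKron_mulVec i (hB.differentiable (by simp) x) (hψ.differentiable (by simp) x)]
  simp only [kronecker_add, oneKron_sub_mulVec, add_mulVec, mulVec_add, mulVec_mulVec,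
    ← mul_kronecker_mul, one_mul]
  abel

/-- The commutator of covariant derivatives is the curvature. -/
theorem covDSpinor_comm (hA : ∀ i, ContDiff ℝ (⊤ : ℕ∞) (A i))
    (hψ : ContDiff ℝ (⊤ : ℕ∞) ψ) (i j : Fin 3) (x : Fin 3 → ℝ) :
    covDSpinor A i (fun y => covDSpinor A j ψ y) x
      = covDSpinor A j (fun y => covDSpinor A i ψ y) x
        + ((1 : M2) ⊗ₖ curv A i j x) *ᵥ ψ x := by
  have hexp (k l : Fin 3) : covDSpinor A k (fun y => covDSpinor A l ψ y) x
      = pd k (fun y => pd l ψ y) x + ((1 : M2) ⊗ₖ A l x) *ᵥ pd k ψ x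
        + ((1 : M2) ⊗ₖ pd k (A l) x) *ᵥ ψ x + ((1 : M2) ⊗ₖ A k x) *ᵥ pd l ψ x
        + ((1 : M2) ⊗ₖ (A k x * A l x)) *ᵥ ψ x := by
    simp only [covDSpinor]
    rw [pd_add k ((contDiff_pd l hψ).differentiable (by simp) x)
        ((contDiff_oneKron_mulVec (hA l) hψ).differentiable (by simp) x),
      pd_oneKron_mulVec k ((hA l).differentiable (by simp) x) (hψ.differentiable (by simp) x),
      mulVec_add, mulVec_mulVec, ← mul_kronecker_mul, one_mul]
    abel
  rw [hexp, hexp, pd_comm i j hψ, curv, kronecker_add, add_mulVec,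
    oneKron_sub_mulVec, oneKron_sub_mulVec]
  abel

end CovariantDerivative

section Sigma

theorem sigma_mul_self (i : Fin 3) : sigma i * sigma i = -1 := by
  fin_cases i <;> ext a b <;> fin_cases a <;> fin_cases b <;> simp [sigma]

theorem sigma_mul_succ (i : Fin 3) : sigma i * sigma (i + 1) = -sigma (i + 2) := by
  fin_cases i <;> ext a b <;> fin_cases a <;> fin_cases b <;> simp [sigma]

theorem sigma_succ_mul (i : Fin 3) : sigma (i + 1) * sigma i = sigma (i + 2) := by
  fin_cases i <;> ext a b <;> fin_cases a <;> fin_cases b <;> simp [sigma]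

end Sigma

end SpinorCalculus

/-- The Weitzenböck-type identity for the coupled Dirac operator of a solution
of the Bogomolny equations: `D_z D*_z ψ = -Σᵢ ∇ᵢ∇ᵢψ - (I⊗Φ + iz·I⊗I)² ψ`. -/
theorem dirac_weitzenboeck (A : Fin 3 → (Fin 3 → ℝ) → M2)
    (hA : ∀ i, ContDiff ℝ (⊤ : ℕ∞) (A i)) (hAsu : ∀ i x, isSu2 (A i x))
    (Φ : (Fin 3 → ℝ) → M2) (hΦ : ContDiff ℝ (⊤ : ℕ∞) Φ) (hΦsu : ∀ x, isSu2 (Φ x))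
    (hBog : Bogomolny A Φ) (z : ℝ)
    (ψ : (Fin 3 → ℝ) → (Fin 2 × Fin 2 → ℂ)) (hψ : ContDiff ℝ (⊤ : ℕ∞) ψ) (x : Fin 3 → ℝ) :
    dirac A Φ z (fun y => diracStar A Φ z ψ y) x
      = -(∑ i : Fin 3, covDSpinor A i (fun y => covDSpinor A i ψ y) x)
        - ((((1 : M2) ⊗ₖ Φ x) + (Complex.I * (z : ℂ)) • ((1 : M2) ⊗ₖ (1 : M2))) *
            (((1 : M2) ⊗ₖ Φ x) + (Complex.I * (z : ℂ)) • ((1 : M2) ⊗ₖ (1 : M2)))).mulVec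
            (ψ x) := by
  set c : ℂ := Complex.I * (z : ℂ) with hc
  have hneg (S : M2) : ((-S) ⊗ₖ (1 : M2)) = -(S ⊗ₖ (1 : M2)) := by
    rw [← neg_one_smul ℂ S, smul_kronecker, neg_one_smul]
  have hsq (i : Fin 3) (v : Fin 2 × Fin 2 → ℂ) :
      (sigma i ⊗ₖ (1 : M2)) *ᵥ (sigma i ⊗ₖ (1 : M2)) *ᵥ v = -v := by
    rw [mulVec_mulVec, ← mul_kronecker_mul, sigma_mul_self, mul_one, hneg, one_kronecker_one,
      neg_mulVec, one_mulVec]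
  have hup (i : Fin 3) (v : Fin 2 × Fin 2 → ℂ) :
      (sigma i ⊗ₖ (1 : M2)) *ᵥ (sigma (i + 1) ⊗ₖ (1 : M2)) *ᵥ v
        = -((sigma (i + 2) ⊗ₖ (1 : M2)) *ᵥ v) := by
    rw [mulVec_mulVec, ← mul_kronecker_mul, sigma_mul_succ, mul_one, hneg, neg_mulVec]
  have hdown (i : Fin 3) (v : Fin 2 × Fin 2 → ℂ) :
      (sigma (i + 1) ⊗ₖ (1 : M2)) *ᵥ (sigma i ⊗ₖ (1 : M2)) *ᵥ v
        = (sigma (i + 2) ⊗ₖ (1 : M2)) *ᵥ v := by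
    rw [mulVec_mulVec, ← mul_kronecker_mul, sigma_succ_mul, mul_one]
  have hP (y : Fin 3 → ℝ) : ((1 : M2) ⊗ₖ Φ y) + c • ((1 : M2) ⊗ₖ (1 : M2))
      = (1 : M2) ⊗ₖ (Φ y + c • 1) := by
    rw [kronecker_add, kronecker_smul]
  have hΦc : ContDiff ℝ (⊤ : ℕ∞) (fun y => Φ y + c • (1 : M2)) := hΦ.add contDiff_const
  have hcov (i : Fin 3) : covD A i (fun y => Φ y + c • (1 : M2)) x = covD A i Φ x := by
    simp only [covD]
    rw [pd_add i (hΦ.differentiable (by simp) x) (differentiableAt_const _)]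
    simp [pd, mul_add, add_mul]
  have hS (j : Fin 3) : ContDiff ℝ (⊤ : ℕ∞)
      (fun y => (sigma j ⊗ₖ (1 : M2)) *ᵥ covDSpinor A j ψ y) :=
    contDiff_const_mulVec _ (contDiff_covDSpinor hA hψ j)
  have hPS (i : Fin 3) (v : Fin 2 × Fin 2 → ℂ) :
      ((1 : M2) ⊗ₖ (Φ x + c • 1)) *ᵥ (sigma i ⊗ₖ (1 : M2)) *ᵥ v
        = (sigma i ⊗ₖ (1 : M2)) *ᵥ ((1 : M2) ⊗ₖ (Φ x + c • 1)) *ᵥ v := by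
    simp only [mulVec_mulVec, ← mul_kronecker_mul, one_mul, mul_one]
  have hstar (i : Fin 3) : covDSpinor A i (fun y => diracStar A Φ z ψ y) x
      = (sigma 0 ⊗ₖ (1 : M2)) *ᵥ covDSpinor A i (fun y => covDSpinor A 0 ψ y) x
        + (sigma 1 ⊗ₖ (1 : M2)) *ᵥ covDSpinor A i (fun y => covDSpinor A 1 ψ y) x
        + (sigma 2 ⊗ₖ (1 : M2)) *ᵥ covDSpinor A i (fun y => covDSpinor A 2 ψ y) x
        + (((1 : M2) ⊗ₖ covD A i Φ x) *ᵥ ψ x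
          + ((1 : M2) ⊗ₖ (Φ x + c • 1)) *ᵥ covDSpinor A i ψ x) := by
    simp only [diracStar, Fin.sum_univ_three]
    simp only [← hc, hP]
    rw [covDSpinor_add i (((hS 0).add (hS 1)).add (hS 2)) (contDiff_oneKron_mulVec hΦc hψ),
      covDSpinor_add i ((hS 0).add (hS 1)) (hS 2), covDSpinor_add i (hS 0) (hS 1),
      covDSpinor_oneKron i hΦc hψ, hcov]
    simp only [covDSpinor_kron_one i _ (contDiff_covDSpinor hA hψ _)]
  obtain ⟨h0, h1, h2⟩ := hBog x
  have e0 := covDSpinor_comm hA hψ 1 2 x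
  have e1 := covDSpinor_comm hA hψ 2 0 x
  have e2 := covDSpinor_comm hA hψ 0 1 x
  rw [h0] at e0
  rw [h1] at e1
  rw [h2] at e2
  simp only [dirac, Fin.sum_univ_three, hstar]
  simp only [diracStar, Fin.sum_univ_three]
  simp only [← hc, hP, e0, e1, e2, mulVec_add, hPS, hsq]
  have u0 := hup 0
  have u1 := hup 1
  have u2 := hup 2
  have d0 := hdown 0
  have d1 := hdown 1
  have d2 := hdown 2
  simp only [Fin.reduceAdd, zero_add] at u0 u1 u2 d0 d1 d2
  simp only [u0, u1, u2, d0, d1, d2, ← mulVec_mulVec]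
  abel
end
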